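/- arXiv:1507.03058 — 2 statements merged into one kernel-verified Lean document; each statement's English description precedes it below -/
import Mathlib

section
/- Let A, B be nonempty words over 𝔸 = {a,b} with A·B ≠ B·A, and let W_0, δ_a, δ_b be as in the context. If W = V·A with V in the submonoid generated by {A,B} and |W| > |W_0|, then δ_a·W_0 is a suffix of W; similarly, if W = V·B with V in the submonoid generated by {A,B} and |W| > |W_0|, then δ_b·W_0 is a suffix of W. -/
namespace Subst

/-- `pow A m` is the `m`-fold concatenation `A^m`. -/
def pow (A : List Bool) : ℕ → List Bool
  | 0 => []
  | n + 1 => pow A n ++ A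

/-- Membership in the submonoid of `𝔸*` generated by `{A, B}`. -/
inductive GenAB (A B : List Bool) : List Bool → Prop
  | nil : GenAB A B []
  | appA : ∀ {W}, GenAB A B W → GenAB A B (W ++ A)
  | appB : ∀ {W}, GenAB A B W → GenAB A B (W ++ B)

/-- The extension of a substitution `σ : 𝔸 → 𝔸*` to a monoid morphism of `𝔸*`. -/
def subst (σ : Bool → List Bool) : List Bool → List Bool
  | [] => []
  | c :: w => σ c ++ subst σ w

/-- The factor `ξ[i, i+n)` of the infinite sequence `ξ`. -/
def wordAt (ξ : ℕ → Bool) (i n : ℕ) : List Bool :=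
  (List.range n).map fun k => ξ (i + k)

/-- `W` is a factor of the infinite sequence `ξ`. -/
def IsFactor (ξ : ℕ → Bool) (W : List Bool) : Prop :=
  ∃ i, W = wordAt ξ i W.length

/-- `ξ` is a fixed point of `σ`: for every `n`, `σ(ξ[0,n))` is a prefix of `ξ`. -/
def IsFixedPoint (σ : Bool → List Bool) (ξ : ℕ → Bool) : Prop :=
  ∀ n, subst σ (wordAt ξ 0 n) = wordAt ξ 0 (subst σ (wordAt ξ 0 n)).length

/-- `ξ` is recurrent: every factor occurs at infinitely many positions. -/
def Recurrent (ξ : ℕ → Bool) : Prop :=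
  ∀ W, IsFactor ξ W → ∀ N, ∃ i, N ≤ i ∧ W = wordAt ξ i W.length

/-- `ξ` is ultimately periodic. -/
def UltPeriodic (ξ : ℕ → Bool) : Prop :=
  ∃ p, 1 ≤ p ∧ ∃ N, ∀ n, N ≤ n → ξ (n + p) = ξ n

/-- `σ` is non-erasing: the image of each letter is nonempty. -/
def NonErasing (σ : Bool → List Bool) : Prop := ∀ c, σ c ≠ []

/-- `σ` is well-marked: `σ(c)` begins with the letter `c` for each letter `c`. -/
def WellMarked (σ : Bool → List Bool) : Prop := ∀ c, ∃ t, σ c = c :: t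

/-- `σ` is primitive: for some `n ≥ 1`, each letter occurs in `σⁿ(d)` for each letter `d`. -/
def Primitive (σ : Bool → List Bool) : Prop :=
  ∃ n, 1 ≤ n ∧ ∀ c d : Bool, c ∈ (subst σ)^[n] [d]

/-- `W` is a right special factor of `ξ`: both `Wa` and `Wb` are factors of `ξ`. -/
def RightSpecial (ξ : ℕ → Bool) (W : List Bool) : Prop :=
  ∀ c : Bool, IsFactor ξ (W ++ [c])

/-- `W` is a left special factor of `ξ`: both `aW` and `bW` are factors of `ξ`. -/
def LeftSpecial (ξ : ℕ → Bool) (W : List Bool) : Prop :=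
  ∀ c : Bool, IsFactor ξ (c :: W)

/-- A right special factor is strong if all of `aWa, aWb, bWa, bWb` are factors. -/
def StrongSpecial (ξ : ℕ → Bool) (W : List Bool) : Prop :=
  ∀ c d : Bool, IsFactor ξ (c :: (W ++ [d]))

/-- A right special factor is weak if neither `aW` nor `bW` is right special. -/
def WeakSpecial (ξ : ℕ → Bool) (W : List Bool) : Prop :=
  RightSpecial ξ W ∧ ∀ c : Bool, ¬ RightSpecial ξ (c :: W)

/-- The operator `T(W) = W₀ · σ(W)`. -/
def T (σ : Bool → List Bool) (W0 W : List Bool) : List Bool := W0 ++ subst σ W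

/-- Specification of the word `W₀` (the longest common suffix of `A^∞` and `B^∞`)
together with the distinct letters `δ_a, δ_b`:  `δ_c · W₀` is a suffix of some power
of `σ(c)` for each letter `c`, and `δ_a ≠ δ_b`. -/
def W0Spec (σ : Bool → List Bool) (W0 : List Bool) (δ : Bool → Bool) : Prop :=
  δ false ≠ δ true ∧ ∀ c, ∃ m, 1 ≤ m ∧ (δ c :: W0) <:+ pow (σ c) m

/-- The incidence matrix of `σ`: its columns are the Parikh vectors of `σ(a)` and `σ(b)`. -/
def incMat (σ : Bool → List Bool) : Matrix Bool Bool ℤ :=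
  Matrix.of fun c d => ((σ d).count c : ℤ)

end Subst

open Subst
namespace Subst

theorem suffix_append_right_of_suffix {U V : List Bool} (h : U <:+ V) (A : List Bool) :
    U ++ A <:+ V ++ A := by
  obtain ⟨t, rfl⟩ := h
  exact ⟨t, by simp⟩

theorem pow_suffix_pow_succ (A : List Bool) (m : ℕ) : pow A m <:+ pow A (m + 1) := by
  induction m with
  | zero => exact List.nil_suffix
  | succ n ih => exact suffix_append_right_of_suffix ih A

/-- If `d·U` is a suffix of a power of `A`, then it is already a suffix of `U·A`. -/
theorem cons_suffix_append_of_suffix_pow {A U : List Bool} {d : Bool} (hA : A ≠ [])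
    (h : ∃ m, 1 ≤ m ∧ (d :: U) <:+ pow A m) : (d :: U) <:+ U ++ A := by
  obtain ⟨m, -, hm⟩ := h
  have hU : U ++ A <:+ pow A (m + 1) :=
    suffix_append_right_of_suffix ((List.suffix_cons d U).trans hm) A
  refine List.suffix_of_suffix_length_le (hm.trans (pow_suffix_pow_succ A m)) hU ?_
  have := List.length_pos_iff.mpr hA
  simp only [List.length_cons, List.length_append]
  omega

theorem GenAB.suffix_append {A B U V : List Bool} (hA : U <:+ U ++ A) (hB : U <:+ U ++ B)
    (hV : GenAB A B V) : U <:+ U ++ V := by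
  induction hV with
  | nil => simp
  | appA _ ih =>
    rw [← List.append_assoc]
    exact hA.trans (suffix_append_right_of_suffix ih A)
  | appB _ ih =>
    rw [← List.append_assoc]
    exact hB.trans (suffix_append_right_of_suffix ih B)

theorem cons_suffix_append_of_length_lt {C U V : List Bool} {d : Bool}
    (hC : (d :: U) <:+ U ++ C) (hV : U <:+ U ++ V) (hlen : U.length < (V ++ C).length) :
    (d :: U) <:+ V ++ C := by
  have h : (d :: U) <:+ U ++ (V ++ C) := by
    rw [← List.append_assoc]
    exact hC.trans (suffix_append_right_of_suffix hV C)
  exact List.suffix_of_suffix_length_le h (List.suffix_append U (V ++ C)) hlen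

end Subst

/-- If `W = V·A` with `V` in the submonoid generated by `{A,B}` and
`|W| > |W₀|`, then `δ_a·W₀` is a suffix of `W`; similarly for `B` and `δ_b`. -/
theorem statement2 (A B : List Bool) (hA : A ≠ []) (hB : B ≠ [])
    (hAB : A ++ B ≠ B ++ A)
    (W0 : List Bool) (δa δb : Bool) (hδ : δa ≠ δb)
    (hδa : ∃ m, 1 ≤ m ∧ (δa :: W0) <:+ pow A m)
    (hδb : ∃ k, 1 ≤ k ∧ (δb :: W0) <:+ pow B k) :
    (∀ V, GenAB A B V → W0.length < (V ++ A).length → (δa :: W0) <:+ (V ++ A)) ∧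
    (∀ V, GenAB A B V → W0.length < (V ++ B).length → (δb :: W0) <:+ (V ++ B)) := by
  have ha := cons_suffix_append_of_suffix_pow hA hδa
  have hb := cons_suffix_append_of_suffix_pow hB hδb
  have hgen : ∀ V, GenAB A B V → W0 <:+ W0 ++ V := fun V hV =>
    hV.suffix_append ((List.suffix_cons δa W0).trans ha) ((List.suffix_cons δb W0).trans hb)
  exact ⟨fun V hV => cons_suffix_append_of_length_lt ha (hgen V hV),
    fun V hV => cons_suffix_append_of_length_lt hb (hgen V hV)⟩
end

section
/- Let σ be a non-erasing substitution over 𝔸 = {a,b} with A = σ(a), B = σ(b), A·B ≠ B·A, and let W_0 be as in the context. Let ξ be a recurrent fixed point of σ. If W is a factor of ξ, then T(W) = W_0·σ(W) is a factor of ξ. -/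
namespace Subst

lemma pow_append_self (A : List Bool) (m : ℕ) : pow A m ++ A = A ++ pow A m := by
  induction m with
  | zero => simp [pow]
  | succ k ih => rw [pow, ← List.append_assoc, ← ih]

lemma append_suffix_append_right {U V : List Bool} (h : U <:+ V) (X : List Bool) :
    U ++ X <:+ V ++ X := by
  obtain ⟨t, rfl⟩ := h
  exact ⟨t, by simp⟩

/-- A suffix of a power of `A` stays a suffix when `A` is appended to it. -/
lemma suffix_append_of_suffix_pow {A W : List Bool} {m : ℕ} (h : W <:+ pow A m) :
    W <:+ W ++ A := by
  refine List.suffix_of_suffix_length_le ?_ (append_suffix_append_right h A) (by simp)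
  rw [pow_append_self]
  exact h.trans (List.suffix_append A _)

lemma suffix_append_subst {σ : Bool → List Bool} {W : List Bool}
    (h : ∀ c, W <:+ W ++ σ c) (U V : List Bool) (hV : W <:+ V) : W <:+ V ++ subst σ U := by
  induction U generalizing V with
  | nil => simpa [subst] using hV
  | cons c U ih =>
    rw [subst, ← List.append_assoc]
    exact ih _ ((h c).trans (append_suffix_append_right hV _))

lemma subst_append (σ : Bool → List Bool) (U V : List Bool) :
    subst σ (U ++ V) = subst σ U ++ subst σ V := by
  induction U with
  | nil => simp [subst]
  | cons c U ih => simp [subst, ih]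

lemma length_le_length_subst {σ : Bool → List Bool} (hne : NonErasing σ) (U : List Bool) :
    U.length ≤ (subst σ U).length := by
  induction U with
  | nil => simp
  | cons c U ih =>
    have := List.length_pos_of_ne_nil (hne c)
    simp only [subst, List.length_append, List.length_cons]
    omega

@[simp]
lemma length_wordAt (ξ : ℕ → Bool) (i n : ℕ) : (wordAt ξ i n).length = n := by
  simp [wordAt]

lemma wordAt_add (ξ : ℕ → Bool) (i m n : ℕ) :
    wordAt ξ i (m + n) = wordAt ξ i m ++ wordAt ξ (i + m) n := by
  simp [wordAt, List.range_add, Nat.add_assoc, Function.comp_def]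

lemma isFactor_of_append_eq_wordAt {ξ : ℕ → Bool} {U V : List Bool} {i : ℕ}
    (h : U ++ V = wordAt ξ i (U ++ V).length) : IsFactor ξ V := by
  rw [List.length_append, wordAt_add] at h
  exact ⟨i + U.length, (List.append_inj h (by simp)).2⟩

end Subst

open Subst
/-- For a recurrent fixed point `ξ` of a non-erasing substitution `σ`,
if `W` is a factor of `ξ`, then `T(W) = W₀·σ(W)` is a factor of `ξ`. -/
theorem statement4 (σ : Bool → List Bool) (hne : NonErasing σ)
    (hAB : σ false ++ σ true ≠ σ true ++ σ false)
    (W0 : List Bool) (δ : Bool → Bool) (hW0 : W0Spec σ W0 δ)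
    (ξ : ℕ → Bool) (hfix : IsFixedPoint σ ξ) (hrec : Recurrent ξ)
    (W : List Bool) (hW : IsFactor ξ W) :
    IsFactor ξ (T σ W0 W) := by
  obtain ⟨i, hi, hWi⟩ := hrec W hW W0.length
  have hsuffix : W0 <:+ subst σ (wordAt ξ 0 i) := by
    have hletter (c : Bool) : W0 <:+ W0 ++ σ c := by
      obtain ⟨m, -, hm⟩ := hW0.2 c
      exact suffix_append_of_suffix_pow ((List.suffix_cons _ _).trans hm)
    refine List.suffix_of_suffix_length_le
      (suffix_append_subst hletter _ W0 List.suffix_rfl) (List.suffix_append _ _) ?_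
    have := length_le_length_subst hne (wordAt ξ 0 i)
    rw [length_wordAt] at this
    omega
  obtain ⟨t, ht⟩ := hsuffix
  have hξ := hfix (i + W.length)
  rw [wordAt_add, Nat.zero_add, ← hWi, subst_append, ← ht, List.append_assoc] at hξ
  exact isFactor_of_append_eq_wordAt hξ
end
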